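/- arXiv:1002.4123 — 2 statements merged into one kernel-verified Lean document; each statement's English description precedes it below -/
import Mathlib

section
/- For every t ∈ [t0,T], the matrices S₊(t) = Q1 − Q2Q4⁻¹Q2' + B'(t)W⁺(t,0)B(t) and Q₊(t) = S1 + C3'Q4⁻¹C3 − A(t)W⁺(t,0)A'(t) are symmetric positive semidefinite. (Matrix positivity claims in the proof of Proposition 2: these make the reduced Hamiltonian system (ade_gmlt) non-negative.) -/
open Matrix Set
open scoped ENNReal

noncomputable section

section BlockDefs

variable {r mr nr : ℕ}

/-- `A(t) = C3'Q4⁻¹C4 + S2` (blocks taken conformally with `F = [[I,0],[0,0]]`,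
`Sm = H'RH`). -/
def blkA (Cm : Matrix (Fin r ⊕ Fin mr) (Fin r ⊕ Fin nr) ℝ)
    (Qm : Matrix (Fin r ⊕ Fin mr) (Fin r ⊕ Fin mr) ℝ)
    (Sm : Matrix (Fin r ⊕ Fin nr) (Fin r ⊕ Fin nr) ℝ) : Matrix (Fin r) (Fin nr) ℝ :=
  (Cm.toBlocks₂₁)ᵀ * (Qm.toBlocks₂₂)⁻¹ * Cm.toBlocks₂₂ + Sm.toBlocks₁₂

/-- `B(t) = C2' − C4'Q4⁻¹Q2'`. -/
def blkB (Cm : Matrix (Fin r ⊕ Fin mr) (Fin r ⊕ Fin nr) ℝ)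
    (Qm : Matrix (Fin r ⊕ Fin mr) (Fin r ⊕ Fin mr) ℝ) : Matrix (Fin nr) (Fin r) ℝ :=
  (Cm.toBlocks₁₂)ᵀ - (Cm.toBlocks₂₂)ᵀ * (Qm.toBlocks₂₂)⁻¹ * (Qm.toBlocks₁₂)ᵀ

/-- `W(t,ε) = εI + S4 + C4'Q4⁻¹C4`. -/
def blkW (Cm : Matrix (Fin r ⊕ Fin mr) (Fin r ⊕ Fin nr) ℝ)
    (Qm : Matrix (Fin r ⊕ Fin mr) (Fin r ⊕ Fin mr) ℝ)
    (Sm : Matrix (Fin r ⊕ Fin nr) (Fin r ⊕ Fin nr) ℝ) (ε : ℝ) :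
    Matrix (Fin nr) (Fin nr) ℝ :=
  ε • (1 : Matrix (Fin nr) (Fin nr) ℝ) + Sm.toBlocks₂₂ +
    (Cm.toBlocks₂₂)ᵀ * (Qm.toBlocks₂₂)⁻¹ * Cm.toBlocks₂₂

/-- `C(t,ε) = −C1' + C3'Q4⁻¹Q2' + A M B`, `M = W(t,ε)⁻¹`. -/
def blkC (Cm : Matrix (Fin r ⊕ Fin mr) (Fin r ⊕ Fin nr) ℝ)
    (Qm : Matrix (Fin r ⊕ Fin mr) (Fin r ⊕ Fin mr) ℝ)
    (Sm : Matrix (Fin r ⊕ Fin nr) (Fin r ⊕ Fin nr) ℝ) (ε : ℝ) :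
    Matrix (Fin r) (Fin r) ℝ :=
  -(Cm.toBlocks₁₁)ᵀ + (Cm.toBlocks₂₁)ᵀ * (Qm.toBlocks₂₂)⁻¹ * (Qm.toBlocks₁₂)ᵀ +
    blkA Cm Qm Sm * (blkW Cm Qm Sm ε)⁻¹ * blkB Cm Qm

/-- `Q(t,ε) = −(1/ε)AMA' + I + (1/ε)(S1 + C3'Q4⁻¹C3)`. -/
def blkQ (Cm : Matrix (Fin r ⊕ Fin mr) (Fin r ⊕ Fin nr) ℝ)
    (Qm : Matrix (Fin r ⊕ Fin mr) (Fin r ⊕ Fin mr) ℝ)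
    (Sm : Matrix (Fin r ⊕ Fin nr) (Fin r ⊕ Fin nr) ℝ) (ε : ℝ) :
    Matrix (Fin r) (Fin r) ℝ :=
  -((1 / ε) • (blkA Cm Qm Sm * (blkW Cm Qm Sm ε)⁻¹ * (blkA Cm Qm Sm)ᵀ)) + 1 +
    (1 / ε) • (Sm.toBlocks₁₁ + (Cm.toBlocks₂₁)ᵀ * (Qm.toBlocks₂₂)⁻¹ * Cm.toBlocks₂₁)

/-- `S(t,ε) = ε(Q1 − Q2Q4⁻¹Q2' + B'MB)`. -/
def blkS (Cm : Matrix (Fin r ⊕ Fin mr) (Fin r ⊕ Fin nr) ℝ)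
    (Qm : Matrix (Fin r ⊕ Fin mr) (Fin r ⊕ Fin mr) ℝ)
    (Sm : Matrix (Fin r ⊕ Fin nr) (Fin r ⊕ Fin nr) ℝ) (ε : ℝ) :
    Matrix (Fin r) (Fin r) ℝ :=
  ε • (Qm.toBlocks₁₁ - Qm.toBlocks₁₂ * (Qm.toBlocks₂₂)⁻¹ * (Qm.toBlocks₁₂)ᵀ +
    (blkB Cm Qm)ᵀ * (blkW Cm Qm Sm ε)⁻¹ * blkB Cm Qm)

end BlockDefs

/-- The four Penrose equations: `Fp` is the Moore–Penrose pseudoinverse of `F`. -/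
def IsMoorePenrose {α β : Type*} [Fintype α] [Fintype β]
    (F : Matrix α β ℝ) (Fp : Matrix β α ℝ) : Prop :=
  F * Fp * F = F ∧ Fp * F * Fp = Fp ∧ (F * Fp)ᵀ = F * Fp ∧ (Fp * F)ᵀ = Fp * F

section BlockPlusDefs

variable {r mr nr : ℕ}

/-- `C₊(t) = C1 − Q2Q4⁻¹C3 − B'W⁺A'` (with `Wp = W⁺(t,0)`). -/
def blkCplus (Cm : Matrix (Fin r ⊕ Fin mr) (Fin r ⊕ Fin nr) ℝ)
    (Qm : Matrix (Fin r ⊕ Fin mr) (Fin r ⊕ Fin mr) ℝ)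
    (Sm : Matrix (Fin r ⊕ Fin nr) (Fin r ⊕ Fin nr) ℝ)
    (Wp : Matrix (Fin nr) (Fin nr) ℝ) : Matrix (Fin r) (Fin r) ℝ :=
  Cm.toBlocks₁₁ - Qm.toBlocks₁₂ * (Qm.toBlocks₂₂)⁻¹ * Cm.toBlocks₂₁ -
    (blkB Cm Qm)ᵀ * Wp * (blkA Cm Qm Sm)ᵀ

/-- `S₊(t) = Q1 − Q2Q4⁻¹Q2' + B'W⁺B`. -/
def blkSplus (Cm : Matrix (Fin r ⊕ Fin mr) (Fin r ⊕ Fin nr) ℝ)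
    (Qm : Matrix (Fin r ⊕ Fin mr) (Fin r ⊕ Fin mr) ℝ)
    (Wp : Matrix (Fin nr) (Fin nr) ℝ) : Matrix (Fin r) (Fin r) ℝ :=
  Qm.toBlocks₁₁ - Qm.toBlocks₁₂ * (Qm.toBlocks₂₂)⁻¹ * (Qm.toBlocks₁₂)ᵀ +
    (blkB Cm Qm)ᵀ * Wp * blkB Cm Qm

/-- `Q₊(t) = S1 + C3'Q4⁻¹C3 − AW⁺A'`. -/
def blkQplus (Cm : Matrix (Fin r ⊕ Fin mr) (Fin r ⊕ Fin nr) ℝ)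
    (Qm : Matrix (Fin r ⊕ Fin mr) (Fin r ⊕ Fin mr) ℝ)
    (Sm : Matrix (Fin r ⊕ Fin nr) (Fin r ⊕ Fin nr) ℝ)
    (Wp : Matrix (Fin nr) (Fin nr) ℝ) : Matrix (Fin r) (Fin r) ℝ :=
  Sm.toBlocks₁₁ + (Cm.toBlocks₂₁)ᵀ * (Qm.toBlocks₂₂)⁻¹ * Cm.toBlocks₂₁ -
    blkA Cm Qm Sm * Wp * (blkA Cm Qm Sm)ᵀ

end BlockPlusDefs

namespace IsMoorePenrose

variable {n : Type*} [Fintype n] {W P : Matrix n n ℝ}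

/-- The Moore–Penrose pseudoinverse of a symmetric matrix is symmetric. -/
theorem transpose_eq (h : IsMoorePenrose W P) (hW : Wᵀ = W) : Pᵀ = P := by
  obtain ⟨h₁, h₂, h₃, h₄⟩ := h
  rw [transpose_mul, hW] at h₃ h₄
  have h₅ : Pᵀ * W * Pᵀ = Pᵀ := by
    have := congrArg transpose h₂
    rwa [transpose_mul, transpose_mul, hW, ← Matrix.mul_assoc] at this
  have hcomm : P * W = W * P := by
    calc P * W = W * P * W * Pᵀ := by rw [h₁, h₄]
      _ = Pᵀ * W * (P * W) := by rw [Matrix.mul_assoc (W * P), h₄, h₃]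
      _ = Pᵀ * (W * P * W) := by simp only [Matrix.mul_assoc]
      _ = W * P := by rw [h₁, h₃]
  calc Pᵀ = Pᵀ * (W * Pᵀ) := by rw [← Matrix.mul_assoc, h₅]
    _ = Pᵀ * W * P := by rw [h₄, hcomm, Matrix.mul_assoc]
    _ = P := by rw [h₃, ← hcomm, h₂]

/-- The Moore–Penrose pseudoinverse of a positive semidefinite matrix is positive
semidefinite. -/
theorem posSemidef (h : IsMoorePenrose W P) (hW : W.PosSemidef) : P.PosSemidef := by
  have hP := h.transpose_eq (by simpa using hW.isHermitian.eq)
  have := hW.conjTranspose_mul_mul_same P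
  rwa [conjTranspose_eq_transpose_of_trivial, hP, h.2.1] at this

end IsMoorePenrose

/-- The generalized Schur complement of a positive semidefinite block matrix is positive
semidefinite, for any symmetric outer inverse `P` of the lower right block. -/
theorem Matrix.PosSemidef.schurComplement_of_outerInverse {m n : Type*} [Fintype m] [Fintype n]
    [DecidableEq m] {M : Matrix (m ⊕ n) (m ⊕ n) ℝ} (hM : M.PosSemidef)
    {P : Matrix n n ℝ} (hP : Pᵀ = P) (hPM : P * M.toBlocks₂₂ * P = P) :
    (M.toBlocks₁₁ - M.toBlocks₁₂ * P * (M.toBlocks₁₂)ᵀ).PosSemidef := by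
  have h₂₁ : M.toBlocks₂₁ = (M.toBlocks₁₂)ᵀ := by
    ext i j
    simpa [toBlocks₁₂, toBlocks₂₁] using (hM.isHermitian.apply (Sum.inr i) (Sum.inl j)).symm
  have h := hM.conjTranspose_mul_mul_same (fromRows 1 (-(P * (M.toBlocks₁₂)ᵀ)))
  convert h using 1
  nth_rw 5 [← fromBlocks_toBlocks M]
  rw [conjTranspose_eq_transpose_of_trivial, transpose_fromRows, fromCols_mul_fromBlocks,
    fromCols_mul_fromRows, h₂₁]
  have h₃ : M.toBlocks₁₂ * P * M.toBlocks₂₂ * (P * (M.toBlocks₁₂)ᵀ) =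
      M.toBlocks₁₂ * P * (M.toBlocks₁₂)ᵀ := by
    rw [← Matrix.mul_assoc, Matrix.mul_assoc _ P M.toBlocks₂₂, Matrix.mul_assoc _ _ P, hPM]
  simp only [transpose_one, transpose_neg, transpose_mul, transpose_transpose, hP,
    Matrix.one_mul, Matrix.mul_one, Matrix.neg_mul, Matrix.mul_neg, Matrix.add_mul, h₃]
  simp only [Matrix.mul_assoc]
  abel

/-- matrix positivity claims in the proof of Proposition 2.
The matrices `S₊(t) = Q1 − Q2Q4⁻¹Q2' + B'W⁺(t,0)B` and
`Q₊(t) = S1 + C3'Q4⁻¹C3 − AW⁺(t,0)A'` are symmetric positive semidefinite for every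
`t ∈ [t0,T]`, where `W⁺(t,0)` is the Moore–Penrose pseudoinverse of
`W(t,0) = S4 + C4'Q4⁻¹C4`. -/
theorem blkSplus_blkQplus_posSemidef {r mr nr q : ℕ} (hr : 0 < r)
    (t0 T : ℝ) (hT : t0 < T)
    (C : ℝ → Matrix (Fin r ⊕ Fin mr) (Fin r ⊕ Fin nr) ℝ)
    (hC : ContinuousOn C (Icc t0 T))
    (H : ℝ → Matrix (Fin q) (Fin r ⊕ Fin nr) ℝ) (hH : ContinuousOn H (Icc t0 T))
    (Q : ℝ → Matrix (Fin r ⊕ Fin mr) (Fin r ⊕ Fin mr) ℝ)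
    (hQ : ContinuousOn Q (Icc t0 T)) (hQpd : ∀ t ∈ Icc t0 T, (Q t).PosDef)
    (R : ℝ → Matrix (Fin q) (Fin q) ℝ)
    (hR : ContinuousOn R (Icc t0 T)) (hRpd : ∀ t ∈ Icc t0 T, (R t).PosDef)
    (Wp : ℝ → Matrix (Fin nr) (Fin nr) ℝ)
    (hWp : ∀ t ∈ Icc t0 T,
      IsMoorePenrose (blkW (C t) (Q t) ((H t)ᵀ * R t * H t) 0) (Wp t)) :
    ∀ t ∈ Icc t0 T,
      (blkSplus (C t) (Q t) (Wp t)).PosSemidef ∧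
      (blkQplus (C t) (Q t) ((H t)ᵀ * R t * H t) (Wp t)).PosSemidef := by
  intro t ht
  have hP := hWp t ht
  generalize (Wp t) = P at hP ⊢
  have hQt := hQpd t ht
  have hS : ((H t)ᵀ * R t * H t).PosSemidef := by
    simpa using (hRpd t ht).posSemidef.conjTranspose_mul_mul_same (H t)
  generalize (H t)ᵀ * R t * H t = S at hP hS ⊢
  generalize C t = K at hP ⊢
  generalize Q t = G at hP hQt ⊢
  have hG₄ : (G.toBlocks₂₂).PosDef := hQt.submatrix Sum.inr_injective
  have hinv : ((G.toBlocks₂₂)⁻¹)ᵀ = (G.toBlocks₂₂)⁻¹ := by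
    simpa using hG₄.inv.isHermitian.eq
  have hM : (S + (K.toRows₂)ᵀ * (G.toBlocks₂₂)⁻¹ * K.toRows₂).PosSemidef :=
    hS.add (by simpa using hG₄.inv.posSemidef.conjTranspose_mul_mul_same K.toRows₂)
  have hM₂₂ : (S + (K.toRows₂)ᵀ * (G.toBlocks₂₂)⁻¹ * K.toRows₂).toBlocks₂₂ = blkW K G S 0 := by
    rw [blkW, zero_smul, zero_add]
    rfl
  have hM₁₂ : (S + (K.toRows₂)ᵀ * (G.toBlocks₂₂)⁻¹ * K.toRows₂).toBlocks₁₂ = blkA K G S := by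
    rw [blkA, add_comm]
    rfl
  have hW : (blkW K G S 0).PosSemidef := hM₂₂ ▸ hM.submatrix Sum.inr
  have hPsd := hP.posSemidef hW
  constructor
  · refine PosSemidef.add ?_ (by simpa using hPsd.conjTranspose_mul_mul_same (blkB K G))
    refine hQt.posSemidef.schurComplement_of_outerInverse hinv ?_
    rw [nonsing_inv_mul _ ((isUnit_iff_isUnit_det _).mp hG₄.isUnit), Matrix.one_mul]
  · have h := hM.schurComplement_of_outerInverse (P := P) (by simpa using hPsd.isHermitian.eq)
      (by rw [hM₂₂]; exact hP.2.1)
    rw [hM₁₂] at h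
    exact h
end
end

section
/- Fix t ∈ [t0,T] and assume range(A'(t)) ⊆ range(W(t,0)) and range(B(t)) ⊆ range(W(t,0)) (which hold under the assumptions of Proposition 2). Then, as ε ↓ 0: (1/ε)S(t,ε) → S₊(t), ε Q(t,ε) → Q₊(t), and −C'(t,ε) → C₊(t), where S(t,ε) = ε(Q1 − Q2Q4⁻¹Q2' + B'(t)W(t,ε)⁻¹B(t)), Q(t,ε) = −(1/ε)A(t)W(t,ε)⁻¹A'(t) + I + (1/ε)(S1 + C3'Q4⁻¹C3), and C(t,ε) = −C1' + C3'Q4⁻¹Q2' + A(t)W(t,ε)⁻¹B(t). (Remark after Proposition 2.) -/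
open Matrix Set
open scoped ENNReal

noncomputable section

open Topology Filter

theorem IsMoorePenrose.mul_mul_eq_of_range_le {α β γ : Type*} [Fintype α] [Fintype β] [Fintype γ]
    {V : Matrix α β ℝ} {Vp : Matrix β α ℝ} (h : IsMoorePenrose V Vp) {Y : Matrix α γ ℝ}
    (hY : LinearMap.range Y.mulVecLin ≤ LinearMap.range V.mulVecLin) : V * Vp * Y = Y := by
  classical
  refine Matrix.ext_of_mulVec_single fun j => ?_
  obtain ⟨w, hw⟩ := hY ⟨Pi.single j 1, rfl⟩
  simp only [mulVecLin_apply] at hw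
  rw [← mulVec_mulVec, ← hw, mulVec_mulVec, h.1]

theorem IsMoorePenrose.mul_mul_self_of_transpose_eq {α : Type*} [Fintype α]
    {V Vp : Matrix α α ℝ} (h : IsMoorePenrose V Vp) (hV : Vᵀ = V) : V * Vp * Vp = Vp := by
  obtain ⟨h₁, h₂, -, h₄⟩ := h
  have key : V * (Vpᵀ * Vp) = Vp := by
    rw [← Matrix.mul_assoc]
    calc V * Vpᵀ * Vp = (Vp * V)ᵀ * Vp := by rw [transpose_mul, hV]
      _ = Vp := by rw [h₄, h₂]
  calc V * Vp * Vp = V * Vp * (V * (Vpᵀ * Vp)) := by rw [key]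
    _ = V * (Vpᵀ * Vp) := by rw [← Matrix.mul_assoc, h₁]
    _ = Vp := key

/-- The regularized inverse of a positive semidefinite matrix converges to the pseudoinverse
on the range of the matrix. -/
theorem tendsto_inv_smul_one_add_mul {α γ : Type*} [Fintype α] [DecidableEq α] [Fintype γ]
    {V Vp : Matrix α α ℝ} (hV : V.PosSemidef) (h : IsMoorePenrose V Vp) {Y : Matrix α γ ℝ}
    (hY : LinearMap.range Y.mulVecLin ≤ LinearMap.range V.mulVecLin) :
    Tendsto (fun ε : ℝ => (ε • (1 : Matrix α α ℝ) + V)⁻¹ * Y) (𝓝[>] 0) (𝓝 (Vp * Y)) := by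
  have hVV : V * Vp * Vp = Vp := h.mul_mul_self_of_transpose_eq hV.isHermitian
  have hPY : V * Vp * Y = Y := h.mul_mul_eq_of_range_le hY
  have hcont : Continuous fun ε : ℝ => 1 + ε • Vp := by fun_prop
  have hdet : ∀ᶠ ε : ℝ in 𝓝[>] 0, (1 + ε • Vp).det ≠ 0 :=
    (hcont.matrix_det.continuousAt.eventually_ne (by simp)).filter_mono nhdsWithin_le_nhds
  have hinv : Tendsto (fun ε : ℝ => (1 + ε • Vp)⁻¹) (𝓝[>] 0) (𝓝 1) := by
    have hat : ContinuousAt (fun ε : ℝ => (1 + ε • Vp)⁻¹) 0 := by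
      refine ContinuousAt.comp (g := Inv.inv) (continuousAt_matrix_inv _ ?_) hcont.continuousAt
      simp [Ring.inverse_eq_inv']
    have := hat.tendsto.mono_left (nhdsWithin_le_nhds (s := Ioi 0))
    simpa using this
  have hlim : Tendsto (fun ε : ℝ => Vp * (1 + ε • Vp)⁻¹ * Y) (𝓝[>] 0) (𝓝 (Vp * Y)) := by
    have hcm : Continuous fun M : Matrix α α ℝ => Vp * M * Y := by fun_prop
    simpa [Function.comp_def] using (hcm.tendsto 1).comp hinv
  refine hlim.congr' ?_
  filter_upwards [hdet, self_mem_nhdsWithin] with ε hε hpos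
  have hW : IsUnit (ε • (1 : Matrix α α ℝ) + V).det :=
    (isUnit_iff_isUnit_det _).1 ((PosDef.one.smul (mem_Ioi.1 hpos)).add_posSemidef hV).isUnit
  have hWVp : (ε • (1 : Matrix α α ℝ) + V) * Vp = V * Vp * (1 + ε • Vp) := by
    rw [Matrix.add_mul, Matrix.mul_add, Matrix.mul_smul, hVV]
    simp [add_comm]
  have hWY : (ε • (1 : Matrix α α ℝ) + V) * (Vp * (1 + ε • Vp)⁻¹ * Y) = Y := by
    rw [← Matrix.mul_assoc, ← Matrix.mul_assoc, hWVp, Matrix.mul_assoc (V * Vp),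
      mul_nonsing_inv _ (isUnit_iff_ne_zero.2 hε), Matrix.mul_one, hPY]
  rw [← nonsing_inv_mul_cancel_left _ (Vp * (1 + ε • Vp)⁻¹ * Y) hW, hWY]

section BlockLemmas

variable {r mr nr : ℕ} {Cm : Matrix (Fin r ⊕ Fin mr) (Fin r ⊕ Fin nr) ℝ}
  {Qm : Matrix (Fin r ⊕ Fin mr) (Fin r ⊕ Fin mr) ℝ}
  {Sm : Matrix (Fin r ⊕ Fin nr) (Fin r ⊕ Fin nr) ℝ}

theorem blkW_eq_smul_one_add (ε : ℝ) : blkW Cm Qm Sm ε = ε • 1 + blkW Cm Qm Sm 0 := by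
  simp [blkW, add_assoc]

theorem posSemidef_blkW_zero (hQ : Qm.PosSemidef) (hS : Sm.PosSemidef) :
    (blkW Cm Qm Sm 0).PosSemidef := by
  have hS₄ : Sm.toBlocks₂₂.PosSemidef := hS.submatrix Sum.inr
  have hQ₄ : Qm.toBlocks₂₂.PosSemidef := hQ.submatrix Sum.inr
  simpa [blkW] using hS₄.add (hQ₄.inv.conjTranspose_mul_mul_same Cm.toBlocks₂₂)

theorem transpose_blkW (hQ : Qm.PosSemidef) (hS : Sm.PosSemidef) (ε : ℝ) :
    (blkW Cm Qm Sm ε)ᵀ = blkW Cm Qm Sm ε := by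
  have h : (blkW Cm Qm Sm 0)ᵀ = blkW Cm Qm Sm 0 := (posSemidef_blkW_zero hQ hS).isHermitian
  rw [blkW_eq_smul_one_add, transpose_add, h, transpose_smul, transpose_one]

theorem tendsto_mul_inv_blkW_mul (hQ : Qm.PosSemidef) (hS : Sm.PosSemidef)
    {Wp : Matrix (Fin nr) (Fin nr) ℝ} (hWp : IsMoorePenrose (blkW Cm Qm Sm 0) Wp)
    {k l : ℕ} (X : Matrix (Fin k) (Fin nr) ℝ) {Y : Matrix (Fin nr) (Fin l) ℝ}
    (hY : LinearMap.range Y.mulVecLin ≤ LinearMap.range (blkW Cm Qm Sm 0).mulVecLin) :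
    Tendsto (fun ε : ℝ => X * (blkW Cm Qm Sm ε)⁻¹ * Y) (𝓝[>] 0) (𝓝 (X * Wp * Y)) := by
  have hcm : Continuous fun M : Matrix (Fin nr) (Fin l) ℝ => X * M := by fun_prop
  have := (hcm.tendsto _).comp
    (tendsto_inv_smul_one_add_mul (posSemidef_blkW_zero hQ hS) hWp hY)
  simpa only [Function.comp_def, ← blkW_eq_smul_one_add, ← Matrix.mul_assoc] using this

end BlockLemmas

/-- Remark after Proposition 2. Fix `t ∈ [t0,T]` and assume
`range A'(t) ⊆ range W(t,0)` and `range B(t) ⊆ range W(t,0)`. Then, as `ε ↓ 0`,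
`(1/ε)S(t,ε) → S₊(t)`, `εQ(t,ε) → Q₊(t)` and `−C'(t,ε) → C₊(t)`. -/
theorem blk_limits_eps_to_zero {r mr nr q : ℕ} (hr : 0 < r)
    (t0 T : ℝ) (hT : t0 < T)
    (C : ℝ → Matrix (Fin r ⊕ Fin mr) (Fin r ⊕ Fin nr) ℝ)
    (hC : ContinuousOn C (Icc t0 T))
    (H : ℝ → Matrix (Fin q) (Fin r ⊕ Fin nr) ℝ) (hH : ContinuousOn H (Icc t0 T))
    (Q : ℝ → Matrix (Fin r ⊕ Fin mr) (Fin r ⊕ Fin mr) ℝ)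
    (hQ : ContinuousOn Q (Icc t0 T)) (hQpd : ∀ t ∈ Icc t0 T, (Q t).PosDef)
    (R : ℝ → Matrix (Fin q) (Fin q) ℝ)
    (hR : ContinuousOn R (Icc t0 T)) (hRpd : ∀ t ∈ Icc t0 T, (R t).PosDef)
    (t : ℝ) (ht : t ∈ Icc t0 T)
    (Wp : Matrix (Fin nr) (Fin nr) ℝ)
    (hWp : IsMoorePenrose (blkW (C t) (Q t) ((H t)ᵀ * R t * H t) 0) Wp)
    (hA : LinearMap.range ((blkA (C t) (Q t) ((H t)ᵀ * R t * H t))ᵀ).mulVecLin ≤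
      LinearMap.range (blkW (C t) (Q t) ((H t)ᵀ * R t * H t) 0).mulVecLin)
    (hB : LinearMap.range (blkB (C t) (Q t)).mulVecLin ≤
      LinearMap.range (blkW (C t) (Q t) ((H t)ᵀ * R t * H t) 0).mulVecLin) :
    Tendsto (fun ε : ℝ => (1 / ε) • blkS (C t) (Q t) ((H t)ᵀ * R t * H t) ε)
      (𝓝[>] (0 : ℝ)) (𝓝 (blkSplus (C t) (Q t) Wp)) ∧
    Tendsto (fun ε : ℝ => ε • blkQ (C t) (Q t) ((H t)ᵀ * R t * H t) ε)
      (𝓝[>] (0 : ℝ)) (𝓝 (blkQplus (C t) (Q t) ((H t)ᵀ * R t * H t) Wp)) ∧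
    Tendsto (fun ε : ℝ => -(blkC (C t) (Q t) ((H t)ᵀ * R t * H t) ε)ᵀ)
      (𝓝[>] (0 : ℝ)) (𝓝 (blkCplus (C t) (Q t) ((H t)ᵀ * R t * H t) Wp)) := by
  have hQt : (Q t).PosSemidef := (hQpd t ht).posSemidef
  have hSt : ((H t)ᵀ * R t * H t).PosSemidef := by
    simpa using (hRpd t ht).posSemidef.conjTranspose_mul_mul_same (H t)
  refine ⟨?_, ?_, ?_⟩
  · have hlim := (tendsto_mul_inv_blkW_mul hQt hSt hWp (blkB (C t) (Q t))ᵀ hB).const_add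
      ((Q t).toBlocks₁₁ - (Q t).toBlocks₁₂ * ((Q t).toBlocks₂₂)⁻¹ * ((Q t).toBlocks₁₂)ᵀ)
    refine hlim.congr' ?_
    filter_upwards [self_mem_nhdsWithin] with ε hε
    rw [blkS, smul_smul, one_div_mul_cancel (ne_of_gt hε), one_smul]
  · have hid : Tendsto (fun ε : ℝ => ε • (1 : Matrix (Fin r) (Fin r) ℝ)) (𝓝[>] 0) (𝓝 0) := by
      have hc : Continuous fun ε : ℝ => ε • (1 : Matrix (Fin r) (Fin r) ℝ) := by fun_prop
      simpa using (hc.tendsto 0).mono_left (nhdsWithin_le_nhds (s := Ioi 0))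
    have hlim := hid.add ((tendsto_mul_inv_blkW_mul hQt hSt hWp
      (blkA (C t) (Q t) ((H t)ᵀ * R t * H t)) hA).const_sub
        (((H t)ᵀ * R t * H t).toBlocks₁₁ +
          ((C t).toBlocks₂₁)ᵀ * ((Q t).toBlocks₂₂)⁻¹ * (C t).toBlocks₂₁))
    rw [zero_add] at hlim
    refine hlim.congr' ?_
    filter_upwards [self_mem_nhdsWithin] with ε hε
    rw [blkQ, smul_add, smul_add, smul_neg, smul_smul, smul_smul,
      mul_one_div_cancel (ne_of_gt hε), one_smul, one_smul]
    abel
  · have hQ₄ : ((Q t).toBlocks₂₂)ᵀ = (Q t).toBlocks₂₂ := (hQt.submatrix Sum.inr).isHermitian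
    refine ((tendsto_mul_inv_blkW_mul hQt hSt hWp (blkB (C t) (Q t))ᵀ hA).const_sub
      ((C t).toBlocks₁₁ - (Q t).toBlocks₁₂ * ((Q t).toBlocks₂₂)⁻¹ * (C t).toBlocks₂₁)).congr
        fun ε => ?_
    simp only [blkC, transpose_add, transpose_neg, transpose_mul, transpose_transpose,
      transpose_nonsing_inv, hQ₄, transpose_blkW hQt hSt]
    simp only [Matrix.mul_assoc]
    abel
end
end
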